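/- ECD(c,d) = Cla(c,d) if and only if every conditional block is consistent, i.e., if and only if for all x, y ∈ U, c(x) = c(y) implies d(x) = d(y). -/

import Mathlib

open Finset

/-- Classification confidence `Conf(X→Y) = |X∩Y|/|X|` for the conditional block
`X = c⁻¹(a)` and decision class `Y = d⁻¹(b)`. -/
def Conf {U A B : Type*} [Fintype U] [DecidableEq A] [DecidableEq B]
    (c : U → A) (d : U → B) (a : A) (b : B) : ℚ :=
  ((univ.filter fun x => c x = a ∧ d x = b).card : ℚ) /
    ((univ.filter fun x => c x = a).card : ℚ)

/-- Expected Confidence Dependency: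
`ECD(c,d) = (1/|U|) · Σ_{X ∈ U/c} |X| · max_{Y ∈ U/d} Conf(X→Y)`. -/
def ECD {U A B : Type*} [Fintype U] [Nonempty U] [DecidableEq A] [DecidableEq B]
    (c : U → A) (d : U → B) : ℚ :=
  (∑ a ∈ univ.image c,
      ((univ.filter fun x => c x = a).card : ℚ) *
        (univ.image d).sup' (univ_nonempty.image d) (fun b => Conf c d a b))
    / (Fintype.card U : ℚ)

/-- The positive region `POS_c(d)`: objects whose conditional block is fully
consistent with a single decision class. -/
def POS {U A B : Type*} [Fintype U] [DecidableEq A] [DecidableEq B]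
    (c : U → A) (d : U → B) : Finset U :=
  univ.filter fun x => ∀ y : U, c y = c x → d y = d x

/-- Classical (Pawlak) dependency `Cla(c,d) = |POS_c(d)|/|U|`. -/
def Cla {U A B : Type*} [Fintype U] [DecidableEq A] [DecidableEq B]
    (c : U → A) (d : U → B) : ℚ :=
  ((POS c d).card : ℚ) / (Fintype.card U : ℚ)

theorem Conf_le_one {U A B : Type*} [Fintype U] [DecidableEq A] [DecidableEq B]
    (c : U → A) (d : U → B) (a : A) (b : B) : Conf c d a b ≤ 1 := by
  refine div_le_one_of_le₀ ?_ (Nat.cast_nonneg _)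
  rw [Nat.cast_le]
  exact card_le_card (monotone_filter_right _ fun _ _ h => h.1)

theorem Conf_apply_pos {U A B : Type*} [Fintype U] [DecidableEq A] [DecidableEq B]
    (c : U → A) (d : U → B) (x : U) : 0 < Conf c d (c x) (d x) := by
  refine div_pos ?_ ?_ <;> exact_mod_cast card_pos.2 ⟨x, by simp⟩

theorem Conf_apply_eq_one {U A B : Type*} [Fintype U] [DecidableEq A] [DecidableEq B]
    {c : U → A} {d : U → B} {x : U} (h : ∀ y, c y = c x → d y = d x) :
    Conf c d (c x) (d x) = 1 := by
  have hX : (univ.filter fun y => c y = c x ∧ d y = d x) = univ.filter fun y => c y = c x :=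
    filter_congr fun y _ => ⟨And.left, fun hy => ⟨hy, h y hy⟩⟩
  unfold Conf
  rw [hX]
  exact div_self (by exact_mod_cast (card_pos.2 ⟨x, by simp⟩).ne')

/-- A consistent block lies in the positive region and has maximal confidence `1`. -/
theorem card_POS_fiber_eq {U A B : Type*} [Fintype U] [Nonempty U]
    [DecidableEq A] [DecidableEq B] {c : U → A} {d : U → B} {x : U}
    (h : ∀ y, c y = c x → d y = d x) :
    (((POS c d).filter fun y => c y = c x).card : ℚ) =
      ((univ.filter fun y => c y = c x).card : ℚ) *
        (univ.image d).sup' (univ_nonempty.image d) (fun b => Conf c d (c x) b) := by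
  have hsup : (univ.image d).sup' (univ_nonempty.image d) (fun b => Conf c d (c x) b) = 1 :=
    le_antisymm (sup'_le _ _ fun b _ => Conf_le_one c d _ b)
      ((Conf_apply_eq_one h).ge.trans
        (le_sup' (fun b => Conf c d (c x) b) (mem_image_of_mem d (mem_univ x))))
  have hX : ((POS c d).filter fun y => c y = c x) = univ.filter fun y => c y = c x := by
    ext y
    simp only [POS, mem_filter, mem_univ, true_and, and_iff_right_iff_imp]
    exact fun hy z hz => (h z (hz.trans hy)).trans (h y hy).symm
  rw [hsup, hX, mul_one]

/-- An inconsistent block misses the positive region but has positive maximal confidence. -/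
theorem card_POS_fiber_lt {U A B : Type*} [Fintype U] [Nonempty U]
    [DecidableEq A] [DecidableEq B] {c : U → A} {d : U → B} {x : U}
    (h : ¬∀ y, c y = c x → d y = d x) :
    (((POS c d).filter fun y => c y = c x).card : ℚ) <
      ((univ.filter fun y => c y = c x).card : ℚ) *
        (univ.image d).sup' (univ_nonempty.image d) (fun b => Conf c d (c x) b) := by
  have hX : ((POS c d).filter fun y => c y = c x) = ∅ := by
    refine filter_eq_empty_iff.2 fun y hy hyx => h fun z hz => ?_
    have hy' : ∀ z, c z = c y → d z = d y := (mem_filter.1 hy).2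
    exact (hy' z (hz.trans hyx.symm)).trans (hy' x hyx.symm).symm
  rw [hX, card_empty, Nat.cast_zero]
  refine mul_pos ?_ ((Conf_apply_pos c d x).trans_le
    (le_sup' (fun b => Conf c d (c x) b) (mem_image_of_mem d (mem_univ x))))
  exact_mod_cast card_pos.2 ⟨x, by simp⟩

/-- `ECD(c,d) = Cla(c,d)` iff every conditional block is consistent. -/
theorem ECD_eq_Cla_iff {U A B : Type*} [Fintype U] [Nonempty U]
    [DecidableEq A] [DecidableEq B] (c : U → A) (d : U → B) :
    ECD c d = Cla c d ↔ ∀ x y : U, c x = c y → d x = d y := by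
  have hU : (Fintype.card U : ℚ) ≠ 0 := by exact_mod_cast Fintype.card_ne_zero
  have hPOS : (POS c d).card =
      ∑ a ∈ univ.image c, ((POS c d).filter fun y => c y = a).card :=
    card_eq_sum_card_fiberwise fun x _ => by simp
  unfold ECD Cla
  rw [div_left_inj' hU, hPOS, Nat.cast_sum, eq_comm, sum_eq_sum_iff_of_le]
  · constructor
    · intro h x y hxy
      by_contra hd
      exact (card_POS_fiber_lt fun hy => hd (hy x hxy)).ne
        (h (c y) (mem_image_of_mem c (mem_univ y)))
    · intro h a ha
      obtain ⟨x, -, rfl⟩ := mem_image.1 ha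
      exact card_POS_fiber_eq fun y => h y x
  · intro a ha
    obtain ⟨x, -, rfl⟩ := mem_image.1 ha
    by_cases h : ∀ y, c y = c x → d y = d x
    · exact (card_POS_fiber_eq h).le
    · exact (card_POS_fiber_lt h).le
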